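/- There exists an absolute constant c > 0 with the following property: if ω is a modulus of continuity and C₀ > 0 is such that ω*(x) ≤ C₀ · ω(x) for all x > 0, then for every f in the class Λ_ω(ℝ²) and all bounded normal operators N₁, N₂ on a complex Hilbert space H with N₁ ≠ N₂, one has ‖f(N₁) − f(N₂)‖ ≤ c · C₀ · ‖f‖_{Λ_ω} · ω(‖N₁ − N₂‖). -/

import Mathlib

open MeasureTheory

/-- A modulus of continuity: a continuous nondecreasing subadditive function
`ω : [0,∞) → [0,∞)` with `ω(0) = 0` and `ω(t) > 0` for `t > 0`. -/
structure IsModulusOfContinuity (ω : ℝ → ℝ) : Prop where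
  continuousOn : ContinuousOn ω (Set.Ici 0)
  monotoneOn : MonotoneOn ω (Set.Ici 0)
  map_zero : ω 0 = 0
  pos : ∀ t : ℝ, 0 < t → 0 < ω t
  subadditive : ∀ s t : ℝ, 0 ≤ s → 0 ≤ t → ω (s + t) ≤ ω s + ω t

/-- `ω*(x) = x ∫_x^∞ ω(t) t⁻² dt`. -/
noncomputable def omegaStar (ω : ℝ → ℝ) (x : ℝ) : ℝ :=
  x * ∫ t in Set.Ioi x, ω t / t ^ 2

/-- The plane wave `z ↦ exp(2πi⟨ξ, z⟩)`, where `⟨·, ·⟩` is the real inner product of `ℂ = ℝ²`. -/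
noncomputable def planeWave (ξ z : ℂ) : ℂ :=
  Complex.exp ((2 * Real.pi * (ξ.re * z.re + ξ.im * z.im) : ℝ) * Complex.I)

lemma norm_planeWave (ξ z : ℂ) : ‖planeWave ξ z‖ = 1 :=
  Complex.norm_exp_ofReal_mul_I _

lemma continuous_planeWave (ξ : ℂ) : Continuous (planeWave ξ) := by
  unfold planeWave
  fun_prop

lemma continuous_planeWave_left (z : ℂ) : Continuous fun ξ => planeWave ξ z := by
  unfold planeWave
  fun_prop

lemma planeWave_comm (ξ z : ℂ) : planeWave ξ z = planeWave z ξ := by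
  unfold planeWave
  congr 4
  ring

lemma planeWave_mul_star (ξ z w : ℂ) :
    planeWave ξ z * star (planeWave ξ w) = planeWave ξ (z - w) := by
  unfold planeWave
  rw [← starRingEnd_apply, ← Complex.exp_conj, ← Complex.exp_add, map_mul, Complex.conj_ofReal,
    Complex.conj_I]
  congr 1
  push_cast [Complex.sub_re, Complex.sub_im]
  ring

lemma planeWave_real_smul (s : ℝ) (ξ z : ℂ) :
    planeWave (s • ξ) z = planeWave ξ (s • z) := by
  unfold planeWave
  simp
  ring_nf

lemma norm_planeWave_sub_le (ξ z w : ℂ) :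
    ‖planeWave ξ z - planeWave ξ w‖ ≤ 2 * Real.pi * ‖ξ‖ * ‖z - w‖ := by
  have h1 : ‖planeWave ξ z - planeWave ξ w‖ = ‖planeWave ξ (z - w) - 1‖ := by
    have hw : planeWave ξ w * star (planeWave ξ w) = 1 := by
      rw [planeWave_mul_star]; simp [planeWave]
    rw [← planeWave_mul_star, ← hw, ← sub_mul, norm_mul, norm_star, norm_planeWave, mul_one]
  rw [h1]
  unfold planeWave
  rw [mul_comm _ Complex.I]
  refine Real.norm_exp_I_mul_ofReal_sub_one_le.trans ?_
  rw [Real.norm_eq_abs, abs_mul, abs_of_pos (by positivity : 0 < 2 * Real.pi), mul_assoc _ ‖ξ‖]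
  gcongr
  have := abs_real_inner_le_norm ξ (z - w)
  rw [Complex.inner] at this
  simpa [mul_comm] using this

lemma exists_bandlimited_kernel :
    ∃ m : ℂ → ℂ, Continuous m ∧ Integrable m ∧ Integrable (fun ξ => ‖ξ‖ * ‖m ξ‖) ∧
      (∫ ξ, m ξ = 1) ∧ ∀ ζ : ℂ, 1 / 2 ≤ ‖ζ‖ → ∫ ξ, m ξ * planeWave ξ ζ = 0 := by
  obtain ⟨b, hbr⟩ : ∃ b : ContDiffBump (0 : ℂ), b.rOut = 1 / 2 :=
    ⟨⟨1 / 4, 1 / 2, by norm_num, by norm_num⟩, rfl⟩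
  have hc : HasCompactSupport (fun z => (b z : ℂ)) :=
    b.hasCompactSupport.comp_left (g := fun x : ℝ => (x : ℂ)) (by simp)
  have hs : ContDiff ℝ ((⊤ : ℕ∞) : WithTop ℕ∞) (fun z => (b z : ℂ)) :=
    Complex.ofRealCLM.contDiff.comp b.contDiff
  let ψ : SchwartzMap ℂ ℂ := hc.toSchwartzMap hs
  have hψ : ∀ z, ψ z = (b z : ℂ) := fun z => rfl
  let φ : SchwartzMap ℂ ℂ := FourierTransform.fourier ψ
  have key : ∀ ζ, ∫ ξ, φ ξ * planeWave ξ ζ = ψ ζ := by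
    intro ζ
    have h : FourierTransformInv.fourierInv φ = ψ := FourierTransform.fourierInv_fourier_eq ψ
    rw [← h, SchwartzMap.fourierInv_coe, Real.fourierInv_eq']
    congr 1
    ext ξ
    rw [smul_eq_mul, mul_comm, planeWave, Complex.inner]
    congr 4
    simp
    ring
  refine ⟨φ, φ.continuous, φ.integrable, ?_, ?_, ?_⟩
  · simpa using φ.integrable_pow_mul volume 1
  · have := key 0
    have h0 : b 0 = 1 := b.one_of_mem_closedBall (by simp [b.rIn_pos.le])
    simpa [planeWave, hψ, h0] using this
  · intro ζ hζ
    rw [key, hψ, b.zero_of_le_dist (by simpa [hbr] using hζ)]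
    simp

section CStar
variable {A : Type*} [CStarAlgebra A]

lemma norm_exp_I_smul_le {a : A} (ha : IsSelfAdjoint a) :
    ‖NormedSpace.exp (Complex.I • a)‖ ≤ 1 := by
  cases subsingleton_or_nontrivial A
  · rw [Subsingleton.elim (NormedSpace.exp (Complex.I • a)) 0, norm_zero]
    exact zero_le_one
  · exact (CStarRing.norm_of_mem_unitary (selfAdjoint.expUnitary ⟨a, ha⟩).2).le

lemma norm_exp_I_smul_sub_le {a b : A} (ha : IsSelfAdjoint a) (hb : IsSelfAdjoint b) :
    ‖NormedSpace.exp (Complex.I • a) - NormedSpace.exp (Complex.I • b)‖ ≤ ‖a - b‖ := by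
  set x : A := Complex.I • a
  set y : A := Complex.I • b
  let F : ℝ → A := fun t => NormedSpace.exp (t • x) * NormedSpace.exp ((1 - t) • y)
  have hF : ∀ t, HasDerivAt F
      (NormedSpace.exp (t • x) * (x - y) * NormedSpace.exp ((1 - t) • y)) t := by
    intro t
    have h1 := hasDerivAt_exp_smul_const (𝕂 := ℝ) x t
    have h2 := (hasDerivAt_exp_smul_const' (𝕂 := ℝ) y (1 - t)).scomp t
      ((hasDerivAt_id t).const_sub 1)
    convert h1.mul h2 using 1
    · rfl
    · simp [mul_add, add_mul, mul_assoc, sub_eq_add_neg]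
  have hI : ∀ (t : ℝ) {c : A}, IsSelfAdjoint c → ‖NormedSpace.exp (t • Complex.I • c)‖ ≤ 1 := by
    intro t c hc
    rw [smul_comm]
    exact norm_exp_I_smul_le ((IsSelfAdjoint.all t).smul hc)
  have := norm_image_sub_le_of_norm_deriv_le_segment_01' (f := F) (C := ‖a - b‖)
    (fun t _ => (hF t).hasDerivWithinAt) (fun t _ => ?_)
  · simpa [F] using this
  · have hxy : ‖x - y‖ = ‖a - b‖ := by simp [x, y, ← smul_sub, norm_smul]
    calc _ ≤ ‖NormedSpace.exp (t • x)‖ * ‖x - y‖ * ‖NormedSpace.exp ((1 - t) • y)‖ :=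
          (norm_mul_le _ _).trans (by gcongr; exact norm_mul_le _ _)
      _ ≤ 1 * ‖a - b‖ * 1 := by
          rw [hxy]
          gcongr
          · exact hI t ha
          · exact hI _ hb
      _ = _ := by ring

lemma cfc_planeWave_eq_exp (ξ : ℂ) (N : A) [IsStarNormal N] :
    cfc (planeWave ξ) N = NormedSpace.exp
      (Complex.I • ((Real.pi * starRingEnd ℂ ξ : ℂ) • N + (Real.pi * ξ : ℂ) • star N)) := by
  have h : (Complex.I • ((Real.pi * starRingEnd ℂ ξ : ℂ) • N + (Real.pi * ξ : ℂ) • star N)) =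
      cfc (fun z : ℂ => (2 * Real.pi * (ξ.re * z.re + ξ.im * z.im) : ℝ) * Complex.I) N := by
    have e : (fun z : ℂ => (2 * Real.pi * (ξ.re * z.re + ξ.im * z.im) : ℝ) * Complex.I) =
        fun z : ℂ => Complex.I * ((Real.pi * starRingEnd ℂ ξ : ℂ) * z +
          (Real.pi * ξ : ℂ) * star z) := by
      ext z
      apply Complex.ext <;> simp <;> ring
    rw [e, cfc_const_mul _ _ N, cfc_add .., cfc_const_mul_id _ N, cfc_const_mul _ _ N,
      cfc_star_id N]
  have hn : IsStarNormal
      (cfc (fun z : ℂ => (2 * Real.pi * (ξ.re * z.re + ξ.im * z.im) : ℝ) * Complex.I) N) :=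
    cfc_predicate _ _
  rw [h, ← CFC.complex_exp_eq_normedSpace_exp, ← cfc_comp' Complex.exp _ N]
  rfl

lemma norm_cfc_planeWave_sub_le (ξ : ℂ) (N₁ N₂ : A) [IsStarNormal N₁] [IsStarNormal N₂] :
    ‖cfc (planeWave ξ) N₁ - cfc (planeWave ξ) N₂‖ ≤ 2 * Real.pi * ‖ξ‖ * ‖N₁ - N₂‖ := by
  have hsa : ∀ N : A, IsSelfAdjoint
      ((Real.pi * starRingEnd ℂ ξ : ℂ) • N + (Real.pi * ξ : ℂ) • star N) := by
    intro N
    rw [IsSelfAdjoint, star_add, star_smul, star_smul, star_star, add_comm]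
    simp
  rw [cfc_planeWave_eq_exp, cfc_planeWave_eq_exp]
  refine (norm_exp_I_smul_sub_le (hsa N₁) (hsa N₂)).trans ?_
  have e : ((Real.pi * starRingEnd ℂ ξ : ℂ) • N₁ + (Real.pi * ξ : ℂ) • star N₁) -
      ((Real.pi * starRingEnd ℂ ξ : ℂ) • N₂ + (Real.pi * ξ : ℂ) • star N₂) =
      (Real.pi * starRingEnd ℂ ξ : ℂ) • (N₁ - N₂) + (Real.pi * ξ : ℂ) • star (N₁ - N₂) := by
    rw [star_sub, smul_sub, smul_sub]
    abel
  rw [e]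
  refine (norm_add_le _ _).trans (le_of_eq ?_)
  rw [norm_smul, norm_smul, norm_star]
  simp [abs_of_pos Real.pi_pos]
  ring

end CStar

/-- The tent function, supported on `[-1, 1]`. -/
noncomputable def tent (t : ℝ) : ℝ := max 0 (1 - |t|)

lemma continuous_tent : Continuous tent := by
  unfold tent
  fun_prop

lemma tent_nonneg (t : ℝ) : 0 ≤ tent t := le_max_left _ _

lemma abs_lt_one_of_tent_ne_zero {t : ℝ} (h : tent t ≠ 0) : |t| < 1 := by
  by_contra! h'
  exact h (max_eq_left (by linarith))

lemma sum_tent_sub_eq_one {n : ℤ} {t : ℝ} (ht : |t| ≤ n) :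
    ∑ j ∈ Finset.Icc (-n - 1) (n + 1), tent (t - j) = 1 := by
  obtain ⟨h1, h2⟩ := abs_le.1 ht
  have hk1 := Int.floor_le t
  have hk2 := Int.lt_floor_add_one t
  set k := ⌊t⌋
  have hkn : k ≤ n := by exact_mod_cast hk1.trans h2
  have hkn' : -n - 1 < k := by
    have : ((-n : ℤ) : ℝ) < ((k + 1 : ℤ) : ℝ) := by push_cast; linarith
    have := Int.cast_lt.1 this
    omega
  have hsub : ({k, k + 1} : Finset ℤ) ⊆ Finset.Icc (-n - 1) (n + 1) := by
    intro j hj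
    simp only [Finset.mem_insert, Finset.mem_singleton] at hj
    rw [Finset.mem_Icc]
    omega
  rw [← Finset.sum_subset hsub, Finset.sum_pair (by omega)]
  · push_cast
    rw [tent, tent, abs_of_nonneg (by linarith), abs_of_nonpos (by linarith),
      max_eq_right (by linarith), max_eq_right (by linarith)]
    ring
  · intro j _ hj
    by_contra h
    obtain ⟨h3, h4⟩ := abs_lt.1 (abs_lt_one_of_tent_ne_zero h)
    have h5 : (j : ℝ) < ((k + 2 : ℤ) : ℝ) := by push_cast; linarith
    have h6 : ((k - 1 : ℤ) : ℝ) < (j : ℝ) := by push_cast; linarith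
    have h5 := Int.cast_lt.1 h5
    have h6 := Int.cast_lt.1 h6
    apply hj
    simp only [Finset.mem_insert, Finset.mem_singleton]
    omega

/-- The points of the square lattice of mesh `s` in `ℂ`. -/
noncomputable def latticePoint (s : ℝ) (i : ℤ × ℤ) : ℂ := ⟨s * i.1, s * i.2⟩

/-- The bump function of the partition of unity subordinate to the lattice of mesh `s`. -/
noncomputable def latticeBump (s : ℝ) (i : ℤ × ℤ) (z : ℂ) : ℝ :=
  tent (z.re / s - i.1) * tent (z.im / s - i.2)

/-- The indices of a square of the lattice. -/
noncomputable def latticeBox (n : ℤ) : Finset (ℤ × ℤ) :=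
  Finset.Icc (-n - 1) (n + 1) ×ˢ Finset.Icc (-n - 1) (n + 1)

@[fun_prop]
lemma continuous_latticeBump (s : ℝ) (i : ℤ × ℤ) : Continuous (latticeBump s i) := by
  have := continuous_tent
  unfold latticeBump
  fun_prop

lemma latticeBump_nonneg (s : ℝ) (i : ℤ × ℤ) (z : ℂ) : 0 ≤ latticeBump s i z :=
  mul_nonneg (tent_nonneg _) (tent_nonneg _)

lemma sum_latticeBump {s : ℝ} (hs : 0 < s) {n : ℤ} {z : ℂ} (hz : ‖z‖ ≤ s * n) :
    ∑ i ∈ latticeBox n, latticeBump s i z = 1 := by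
  have h1 : |z.re / s| ≤ n := by
    rw [abs_div, abs_of_pos hs, div_le_iff₀ hs, mul_comm]
    exact (Complex.abs_re_le_norm z).trans hz
  have h2 : |z.im / s| ≤ n := by
    rw [abs_div, abs_of_pos hs, div_le_iff₀ hs, mul_comm]
    exact (Complex.abs_im_le_norm z).trans hz
  unfold latticeBump latticeBox
  rw [Finset.sum_product, ← sum_tent_sub_eq_one h1]
  refine Finset.sum_congr rfl fun j _ => ?_
  dsimp only
  rw [← Finset.mul_sum, sum_tent_sub_eq_one h2, mul_one]

lemma dist_latticePoint_lt {s : ℝ} (hs : 0 < s) {i : ℤ × ℤ} {z : ℂ}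
    (h : latticeBump s i z ≠ 0) : ‖z - latticePoint s i‖ < 2 * s := by
  have h1 := abs_lt_one_of_tent_ne_zero (left_ne_zero_of_mul h)
  have h2 := abs_lt_one_of_tent_ne_zero (right_ne_zero_of_mul h)
  have e1 : |z.re - s * i.1| = s * |z.re / s - i.1| := by
    rw [← abs_of_pos hs, ← abs_mul, abs_of_pos hs]
    congr 1
    field_simp
  have e2 : |z.im - s * i.2| = s * |z.im / s - i.2| := by
    rw [← abs_of_pos hs, ← abs_mul, abs_of_pos hs]
    congr 1
    field_simp
  refine (Complex.norm_le_abs_re_add_abs_im _).trans_lt ?_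
  simp only [Complex.sub_re, Complex.sub_im, latticePoint]
  rw [e1, e2]
  nlinarith

lemma abs_sub_le_of_norm_latticePoint_sub_lt {s : ℝ} (hs : 0 < s) {i j : ℤ × ℤ} {k : ℤ}
    (h : ‖latticePoint s i - latticePoint s j‖ < (k + 1) * s) :
    j ∈ Finset.Icc (i.1 - k) (i.1 + k) ×ˢ Finset.Icc (i.2 - k) (i.2 + k) := by
  have key : ∀ a b : ℤ, |s * a - s * b| < (k + 1) * s → a - k ≤ b ∧ b ≤ a + k := by
    intro a b hab
    rw [← mul_sub, abs_mul, abs_of_pos hs, mul_comm, mul_lt_mul_iff_left₀ hs] at hab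
    have : |a - b| < k + 1 := by exact_mod_cast hab
    rw [abs_lt] at this
    omega
  have h1 := key i.1 j.1 ((Complex.abs_re_le_norm _).trans_lt h)
  have h2 := key i.2 j.2 ((Complex.abs_im_le_norm _).trans_lt h)
  simp only [Finset.mem_product, Finset.mem_Icc]
  exact ⟨h1, h2⟩

section CStar
variable {A : Type*} [CStarAlgebra A]

lemma norm_one_le_one : ‖(1 : A)‖ ≤ 1 := by
  cases subsingleton_or_nontrivial A
  · rw [Subsingleton.elim (1 : A) 0, norm_zero]
    exact zero_le_one
  · exact norm_one.le

lemma norm_le_of_mem_spectrum {N : A} {z : ℂ} (hz : z ∈ spectrum ℂ N) : ‖z‖ ≤ ‖N‖ :=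
  (spectrum.norm_le_norm_mul_of_mem hz).trans
    (mul_le_of_le_one_right (norm_nonneg _) norm_one_le_one)

lemma norm_cfc_planeWave_le (ξ : ℂ) (N : A) : ‖cfc (planeWave ξ) N‖ ≤ 1 :=
  norm_cfc_le zero_le_one fun z _ => (norm_planeWave ξ z).le

lemma cfc_planeWave_mul_star (ξ : ℂ) (N : A) [IsStarNormal N] :
    cfc (planeWave ξ) N * star (cfc (planeWave ξ) N) = 1 := by
  have hc := continuous_planeWave ξ
  rw [← cfc_star, ← cfc_mul _ _ N, ← cfc_const_one ℂ N]
  congr 1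
  ext z
  rw [planeWave_mul_star]
  simp [planeWave]

lemma continuous_cfc_planeWave (N : A) [IsStarNormal N] :
    Continuous fun ξ => cfc (planeWave ξ) N := by
  have : LipschitzWith (Real.toNNReal (2 * Real.pi * ‖N‖)) fun ξ => cfc (planeWave ξ) N := by
    refine LipschitzWith.of_dist_le' fun ξ η => ?_
    have h1 := continuous_planeWave ξ
    have h2 := continuous_planeWave η
    rw [dist_eq_norm, dist_eq_norm, ← cfc_sub _ _ N]
    refine norm_cfc_le (by positivity) fun z hz => ?_
    rw [planeWave_comm ξ, planeWave_comm η]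
    refine (norm_planeWave_sub_le z ξ η).trans ?_
    gcongr
    exact norm_le_of_mem_spectrum hz
  exact this.continuous

/-- The operator of the partition of unity of mesh `s` applied to a normal element `N`. -/
noncomputable def bumpOp (s : ℝ) (N : A) (i : ℤ × ℤ) : A :=
  cfc (fun z => (latticeBump s i z : ℂ)) N

lemma star_bumpOp (s : ℝ) (N : A) (i : ℤ × ℤ) : star (bumpOp s N i) = bumpOp s N i := by
  rw [bumpOp, ← cfc_star]
  congr 1
  ext z
  exact Complex.conj_ofReal _

lemma sum_smul_bumpOp (s : ℝ) (N : A) [IsStarNormal N] (J : Finset (ℤ × ℤ)) (a : ℤ × ℤ → ℂ) :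
    ∑ i ∈ J, a i • bumpOp s N i = cfc (fun z => ∑ i ∈ J, a i * latticeBump s i z) N := by
  rw [← Finset.sum_fn, cfc_sum _ N J]
  refine Finset.sum_congr rfl fun i _ => ?_
  rw [cfc_const_mul _ _ N, bumpOp]

lemma norm_cfc_sub_sum_le {s : ℝ} (hs : 0 < s) {n : ℤ} (N : A) [IsStarNormal N]
    (hN : ‖N‖ ≤ s * n) {g : ℂ → ℂ} (hg : Continuous g) {ε : ℝ} (hε : 0 ≤ ε)
    (h : ∀ z w, ‖z - w‖ < 2 * s → ‖g z - g w‖ ≤ ε) :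
    ‖cfc g N - ∑ i ∈ latticeBox n, g (latticePoint s i) • bumpOp s N i‖ ≤ ε := by
  rw [sum_smul_bumpOp, ← cfc_sub _ _ N]
  refine norm_cfc_le hε fun z hz => ?_
  have h1 := sum_latticeBump hs ((norm_le_of_mem_spectrum hz).trans hN)
  have h2 : g z = ∑ i ∈ latticeBox n, g z * latticeBump s i z := by
    rw [← Finset.mul_sum, ← Complex.ofReal_sum, h1, Complex.ofReal_one, mul_one]
  rw [h2, ← Finset.sum_sub_distrib]
  calc _ ≤ ∑ i ∈ latticeBox n, ε * latticeBump s i z := by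
        refine norm_sum_le_of_le _ fun i _ => ?_
        rw [← sub_mul, norm_mul, Complex.norm_real, Real.norm_of_nonneg (latticeBump_nonneg s i z)]
        by_cases h0 : latticeBump s i z = 0
        · simp [h0]
        · exact mul_le_mul_of_nonneg_right (h _ _ (dist_latticePoint_lt hs h0))
            (latticeBump_nonneg s i z)
    _ = ε := by rw [← Finset.mul_sum, h1, mul_one]

lemma norm_sum_smul_bumpOp_le {s : ℝ} (hs : 0 < s) {n : ℤ} (N : A) [IsStarNormal N]
    (hN : ‖N‖ ≤ s * n) {a : ℤ × ℤ → ℂ} (ha : ∀ i, ‖a i‖ ≤ 1) :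
    ‖∑ i ∈ latticeBox n, a i • bumpOp s N i‖ ≤ 1 := by
  rw [sum_smul_bumpOp]
  refine norm_cfc_le zero_le_one fun z hz => ?_
  rw [← sum_latticeBump hs ((norm_le_of_mem_spectrum hz).trans hN)]
  refine norm_sum_le_of_le _ fun i _ => ?_
  rw [norm_mul, Complex.norm_real, Real.norm_of_nonneg (latticeBump_nonneg s i z)]
  exact mul_le_of_le_one_left (latticeBump_nonneg s i z) (ha i)

/-- `Y` is banded of width `s` relative to `N₁, N₂` when it does not connect spectral subsets at
distance at least `s`. -/
def IsBanded (N₁ N₂ Y : A) (s : ℝ) : Prop :=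
  ∀ g h : ℂ → ℂ, Continuous g → Continuous h →
    (∀ z w, g z ≠ 0 → h w ≠ 0 → s ≤ ‖z - w‖) → cfc g N₁ * Y * cfc h N₂ = 0

lemma IsBanded.sub {N₁ N₂ Y Z : A} {s : ℝ} (hY : IsBanded N₁ N₂ Y s)
    (hZ : IsBanded N₁ N₂ Z s) : IsBanded N₁ N₂ (Y - Z) s := by
  intro g h hg hh hgh
  rw [mul_sub, sub_mul, hY g h hg hh hgh, hZ g h hg hh hgh, sub_zero]

lemma IsBanded.mono {N₁ N₂ Y : A} {s t : ℝ} (hY : IsBanded N₁ N₂ Y s) (hst : s ≤ t) :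
    IsBanded N₁ N₂ Y t :=
  fun g h hg hh hgh => hY g h hg hh fun z w hz hw => hst.trans (hgh z w hz hw)

/-- The Schur multiplier with symbol `(z, w) ↦ m̂((z - w) / s)` applied to the identity. -/
noncomputable def smear (m : ℂ → ℂ) (N₁ N₂ : A) (s : ℝ) : A :=
  ∫ ξ, m ξ • (cfc (planeWave (s⁻¹ • ξ)) N₁ * star (cfc (planeWave (s⁻¹ • ξ)) N₂))

variable {m : ℂ → ℂ} (N₁ N₂ : A) [IsStarNormal N₁] [IsStarNormal N₂]

lemma integrable_smear (hc : Continuous m) (hm : Integrable m) (s : ℝ) :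
    Integrable fun ξ =>
      m ξ • (cfc (planeWave (s⁻¹ • ξ)) N₁ * star (cfc (planeWave (s⁻¹ • ξ)) N₂)) := by
  have h : ∀ N : A, IsStarNormal N → Continuous fun ξ : ℂ => cfc (planeWave (s⁻¹ • ξ)) N :=
    fun N _ => (continuous_cfc_planeWave N).comp (continuous_const_smul _)
  refine hm.mono (hc.smul ((h N₁ inferInstance).mul (h N₂ inferInstance).star)).aestronglyMeasurable
    (Filter.Eventually.of_forall fun ξ => ?_)
  rw [norm_smul]
  refine mul_le_of_le_one_right (norm_nonneg _) ((norm_mul_le _ _).trans ?_)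
  rw [norm_star]
  exact mul_le_one₀ (norm_cfc_planeWave_le _ _) (norm_nonneg _) (norm_cfc_planeWave_le _ _)

lemma norm_one_sub_smear_le (hc : Continuous m) (hm : Integrable m)
    (hm' : Integrable fun ξ => ‖ξ‖ * ‖m ξ‖) (hm1 : ∫ ξ, m ξ = 1) {s : ℝ} (hs : 0 < s) :
    ‖1 - smear m N₁ N₂ s‖ ≤ 2 * Real.pi * (∫ ξ, ‖ξ‖ * ‖m ξ‖) * (‖N₁ - N₂‖ / s) := by
  have h1 : (1 : A) = ∫ ξ, m ξ • (1 : A) := by rw [integral_smul_const, hm1, one_smul]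
  rw [h1, smear, ← integral_sub (hm.smul_const _) (integrable_smear N₁ N₂ hc hm s)]
  calc _ ≤ ∫ ξ, 2 * Real.pi * (‖N₁ - N₂‖ / s) * (‖ξ‖ * ‖m ξ‖) := by
        refine norm_integral_le_of_norm_le (hm'.const_mul _)
          (Filter.Eventually.of_forall fun ξ => ?_)
        rw [← smul_sub, norm_smul, ← cfc_planeWave_mul_star (s⁻¹ • ξ) N₂, ← sub_mul]
        calc _ ≤ ‖m ξ‖ * (2 * Real.pi * ‖s⁻¹ • ξ‖ * ‖N₁ - N₂‖ * 1) := by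
              gcongr
              refine (norm_mul_le _ _).trans ?_
              rw [norm_star, norm_sub_rev]
              gcongr
              · exact norm_cfc_planeWave_sub_le _ _ _
              · exact norm_cfc_planeWave_le _ _
          _ = _ := by
              rw [norm_smul, Real.norm_of_nonneg (inv_nonneg.2 hs.le)]
              ring
    _ = _ := by
        rw [integral_const_mul]
        ring

lemma isBanded_smear (hc : Continuous m) (hm : Integrable m)
    (hm' : Integrable fun ξ => ‖ξ‖ * ‖m ξ‖)
    (hm0 : ∀ ζ : ℂ, 1 / 2 ≤ ‖ζ‖ → ∫ ξ, m ξ * planeWave ξ ζ = 0) {s : ℝ} (hs : 0 < s) :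
    IsBanded N₁ N₂ (smear m N₁ N₂ s) s := by
  intro g h hg hh hgh
  set K : ℝ := ‖cfc g N₁‖ * (∫ ξ, 8 * Real.pi / s * (‖ξ‖ * ‖m ξ‖)) * ‖cfc h N₂‖
  -- the product is bounded by a multiple of any sufficiently fine mesh
  have key : ∀ ε : ℝ, 0 < ε → ε ≤ s / 8 → ‖cfc g N₁ * smear m N₁ N₂ s * cfc h N₂‖ ≤ K * ε := by
    intro ε hε hεs
    obtain ⟨n, hn⟩ := exists_nat_ge ((‖N₁‖ + ‖N₂‖) / ε)
    rw [div_le_iff₀' hε] at hn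
    have hn1 : ‖N₁‖ ≤ ε * (n : ℤ) := by
      push_cast
      linarith [norm_nonneg N₂]
    have hn2 : ‖N₂‖ ≤ ε * (n : ℤ) := by
      push_cast
      linarith [norm_nonneg N₁]
    let V : A → ℂ → A := fun N ξ => ∑ i ∈ latticeBox n,
      planeWave (s⁻¹ • ξ) (latticePoint ε i) • bumpOp ε N i
    have hV : ∀ ξ, m ξ • (V N₁ ξ * star (V N₂ ξ)) =
        ∑ i ∈ latticeBox n, ∑ j ∈ latticeBox n,
          (m ξ * planeWave ξ (s⁻¹ • (latticePoint ε i - latticePoint ε j))) •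
            (bumpOp ε N₁ i * bumpOp ε N₂ j) := by
      intro ξ
      simp only [V, star_sum, Finset.sum_mul_sum, Finset.smul_sum]
      refine Finset.sum_congr rfl fun i _ => Finset.sum_congr rfl fun j _ => ?_
      rw [star_smul, star_bumpOp, smul_mul_smul_comm, smul_smul, planeWave_mul_star,
        planeWave_real_smul]
    have hint : ∀ ζ : ℂ, Integrable fun ξ => m ξ * planeWave ξ ζ := by
      intro ζ
      refine hm.mono (hc.mul (continuous_planeWave_left ζ)).aestronglyMeasurable
        (Filter.Eventually.of_forall fun ξ => ?_)
      rw [norm_mul, norm_planeWave, mul_one]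
    have hVint : Integrable fun ξ => m ξ • (V N₁ ξ * star (V N₂ ξ)) := by
      simp only [hV]
      exact integrable_finsetSum _ fun i _ => integrable_finsetSum _ fun j _ =>
        (hint _).smul_const _
    have hdiff : ‖smear m N₁ N₂ s - ∫ ξ, m ξ • (V N₁ ξ * star (V N₂ ξ))‖ ≤
        (∫ ξ, 8 * Real.pi / s * (‖ξ‖ * ‖m ξ‖)) * ε := by
      rw [smear, ← integral_sub (integrable_smear N₁ N₂ hc hm s) hVint, ← integral_mul_const]
      refine norm_integral_le_of_norm_le ((hm'.const_mul _).mul_const _)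
          (Filter.Eventually.of_forall fun ξ => ?_)
      have hs' : ‖s⁻¹ • ξ‖ = s⁻¹ * ‖ξ‖ := by
        rw [norm_smul, Real.norm_of_nonneg (inv_nonneg.2 hs.le)]
      have happ : ∀ N : A, IsStarNormal N → ‖N‖ ≤ ε * (n : ℤ) →
          ‖cfc (planeWave (s⁻¹ • ξ)) N - V N ξ‖ ≤ 2 * Real.pi * ‖s⁻¹ • ξ‖ * (2 * ε) := by
        intro N _ hN
        refine norm_cfc_sub_sum_le hε N hN (continuous_planeWave _) (by positivity) ?_
        intro z w hzw
        refine (norm_planeWave_sub_le _ z w).trans ?_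
        gcongr
      have hV1 : ‖V N₂ ξ‖ ≤ 1 :=
        norm_sum_smul_bumpOp_le hε N₂ hn2 fun i => (norm_planeWave _ _).le
      have hU1 := norm_cfc_planeWave_le (s⁻¹ • ξ) N₁
      have ha1 := happ N₁ inferInstance hn1
      have ha2 := happ N₂ inferInstance hn2
      set U₁ := cfc (planeWave (s⁻¹ • ξ)) N₁
      set U₂ := cfc (planeWave (s⁻¹ • ξ)) N₂
      have e : U₁ * star U₂ - V N₁ ξ * star (V N₂ ξ) =
          U₁ * star (U₂ - V N₂ ξ) + (U₁ - V N₁ ξ) * star (V N₂ ξ) := by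
        rw [star_sub]
        noncomm_ring
      rw [← smul_sub, norm_smul, e]
      calc _ ≤ ‖m ξ‖ * (1 * (2 * Real.pi * ‖s⁻¹ • ξ‖ * (2 * ε)) +
            (2 * Real.pi * ‖s⁻¹ • ξ‖ * (2 * ε)) * 1) := by
            gcongr
            refine (norm_add_le _ _).trans (add_le_add ?_ ?_)
            · refine (norm_mul_le _ _).trans ?_
              rw [norm_star]
              gcongr
            · refine (norm_mul_le _ _).trans ?_
              rw [norm_star]
              gcongr
        _ = _ := by
            rw [hs']
            field_simp
            ring
    have hzero : cfc g N₁ * (∫ ξ, m ξ • (V N₁ ξ * star (V N₂ ξ))) * cfc h N₂ = 0 := by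
      simp only [hV]
      rw [integral_finsetSum _ fun i _ => integrable_finsetSum _ fun j _ =>
        (hint _).smul_const _, Finset.mul_sum, Finset.sum_mul]
      refine Finset.sum_eq_zero fun i _ => ?_
      rw [integral_finsetSum _ fun j _ => (hint _).smul_const _, Finset.mul_sum, Finset.sum_mul]
      refine Finset.sum_eq_zero fun j _ => ?_
      rw [integral_smul_const]
      have e : cfc g N₁ * (bumpOp ε N₁ i * bumpOp ε N₂ j) * cfc h N₂ =
          cfc (fun z => g z * latticeBump ε i z) N₁ *
            cfc (fun z => latticeBump ε j z * h z) N₂ := by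
        rw [cfc_mul _ _ N₁, cfc_mul _ _ N₂, bumpOp, bumpOp]
        noncomm_ring
      rw [mul_smul_comm, smul_mul_assoc, e]
      by_cases h1 : ∃ z, g z * latticeBump ε i z ≠ 0
      · by_cases h2 : ∃ w, (latticeBump ε j w : ℂ) * h w ≠ 0
        · obtain ⟨z, hz⟩ := h1
          obtain ⟨w, hw⟩ := h2
          have hzw := hgh z w (left_ne_zero_of_mul hz) (right_ne_zero_of_mul hw)
          have hzi := dist_latticePoint_lt hε (by exact_mod_cast right_ne_zero_of_mul hz)
          have hwj := dist_latticePoint_lt hε (by exact_mod_cast left_ne_zero_of_mul hw)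
          rw [hm0, zero_smul]
          rw [norm_smul, Real.norm_of_nonneg (inv_nonneg.2 hs.le), inv_mul_eq_div,
            le_div_iff₀ hs]
          have e2 : z - w = (z - latticePoint ε i) + (latticePoint ε i - latticePoint ε j) -
              (w - latticePoint ε j) := by ring
          have h3 := norm_sub_le ((z - latticePoint ε i) + (latticePoint ε i - latticePoint ε j))
              (w - latticePoint ε j)
          have h4 := norm_add_le (z - latticePoint ε i) (latticePoint ε i - latticePoint ε j)
          rw [← e2] at h3
          linarith
        · push Not at h2
          simp [h2]
      · push Not at h1
        simp [h1]
    rw [← sub_zero (cfc g N₁ * smear m N₁ N₂ s * cfc h N₂), ← hzero, ← sub_mul, ← mul_sub]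
    calc _ ≤ ‖cfc g N₁‖ * ((∫ ξ, 8 * Real.pi / s * (‖ξ‖ * ‖m ξ‖)) * ε) * ‖cfc h N₂‖ := by
          refine (norm_mul_le _ _).trans ?_
          gcongr
          refine (norm_mul_le _ _).trans ?_
          gcongr
      _ = K * ε := by ring
  have hlim : Filter.Tendsto (fun ε => K * ε) (nhdsWithin 0 (Set.Ioi 0)) (nhds 0) := by
    have : Filter.Tendsto (fun ε : ℝ => K * ε) (nhds 0) (nhds (K * 0)) := by
      exact (continuous_const_mul K).tendsto 0
    rw [mul_zero] at this
    exact this.mono_left nhdsWithin_le_nhds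
  have := ge_of_tendsto hlim (b := ‖cfc g N₁ * smear m N₁ N₂ s * cfc h N₂‖) (by
    filter_upwards [Ioc_mem_nhdsGT (by positivity : 0 < s / 8)] with ε hε
    exact key ε hε.1 hε.2)
  exact norm_le_zero_iff.1 this

end CStar

section Schur
variable {H : Type*} [NormedAddCommGroup H] [InnerProductSpace ℂ H] [CompleteSpace H]

lemma sum_comp_le_card_mul {α β : Type*} [DecidableEq β] (S : Finset α) (J : Finset β)
    (π : α → β) (hπ : ∀ p ∈ S, π p ∈ J) {K : ℕ} (hK : ∀ j ∈ J, (S.filter (π · = j)).card ≤ K)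
    (g : β → ℝ) (hg : ∀ j, 0 ≤ g j) : ∑ p ∈ S, g (π p) ≤ K * ∑ j ∈ J, g j := by
  rw [← Finset.sum_fiberwise_of_maps_to hπ, Finset.mul_sum]
  refine Finset.sum_le_sum fun j hj => ?_
  rw [Finset.sum_congr rfl (g := fun _ => g j) fun p hp => by rw [(Finset.mem_filter.1 hp).2],
    Finset.sum_const, nsmul_eq_mul]
  exact mul_le_mul_of_nonneg_right (by exact_mod_cast hK j hj) (hg j)

lemma norm_sum_smul_mul_mul_le {ι : Type*} [DecidableEq ι] (J : Finset ι) (S : Finset (ι × ι))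
    (hS : S ⊆ J ×ˢ J) {K : ℕ} (hK₁ : ∀ i ∈ J, (S.filter (·.1 = i)).card ≤ K)
    (hK₂ : ∀ j ∈ J, (S.filter (·.2 = j)).card ≤ K) (P Q : ι → H →L[ℂ] H)
    (hPstar : ∀ i, star (P i) = P i)
    (hP : ∀ x, ∑ i ∈ J, ‖P i x‖ ^ 2 ≤ ‖x‖ ^ 2) (hQ : ∀ x, ∑ i ∈ J, ‖Q i x‖ ^ 2 ≤ ‖x‖ ^ 2)
    (Y : H →L[ℂ] H) (a : ι × ι → ℂ) {ε : ℝ} (hε : 0 ≤ ε) (ha : ∀ p ∈ S, ‖a p‖ ≤ ε) :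
    ‖∑ p ∈ S, a p • (P p.1 * Y * Q p.2)‖ ≤ K * ε * ‖Y‖ := by
  set T := ∑ p ∈ S, a p • (P p.1 * Y * Q p.2) with hT
  have hsum : ∀ (R : ι → H →L[ℂ] H) (π : ι × ι → ι) (x : H), (∀ p ∈ S, π p ∈ J) →
      (∀ j ∈ J, (S.filter (π · = j)).card ≤ K) → (∑ i ∈ J, ‖R i x‖ ^ 2 ≤ ‖x‖ ^ 2) →
      √(∑ p ∈ S, ‖R (π p) x‖ ^ 2) ≤ √K * ‖x‖ := by
    intro R π x h1 h2 h3
    rw [← Real.sqrt_sq (norm_nonneg x), ← Real.sqrt_mul (Nat.cast_nonneg K)]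
    refine Real.sqrt_le_sqrt ((sum_comp_le_card_mul S J π h1 h2 (fun j => ‖R j x‖ ^ 2)
      fun j => by positivity).trans ?_)
    gcongr
  have hmem : ∀ p ∈ S, p.1 ∈ J ∧ p.2 ∈ J := fun p hp => Finset.mem_product.1 (hS hp)
  have key : ∀ x y : H, ‖inner ℂ y (T x)‖ ≤ K * ε * ‖Y‖ * ‖x‖ * ‖y‖ := by
    intro x y
    rw [hT, sum_apply, inner_sum]
    calc _ ≤ ∑ p ∈ S, ε * ‖Y‖ * (‖Q p.2 x‖ * ‖P p.1 y‖) := by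
          refine norm_sum_le_of_le _ fun p hp => ?_
          have e : inner ℂ y ((a p • (P p.1 * Y * Q p.2)) x) =
              a p * inner ℂ (P p.1 y) (Y (Q p.2 x)) := by
            rw [smul_apply, inner_smul_right, mul_assoc,
              mul_apply_eq_comp, mul_apply_eq_comp]
            congr 1
            conv_lhs => rw [← hPstar, ContinuousLinearMap.star_eq_adjoint,
              ContinuousLinearMap.adjoint_inner_right]
          rw [e, norm_mul]
          calc _ ≤ ε * (‖P p.1 y‖ * (‖Y‖ * ‖Q p.2 x‖)) := by
                gcongr
                · exact ha p hp
                · refine (norm_inner_le_norm _ _).trans ?_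
                  gcongr
                  exact Y.le_opNorm _
            _ = _ := by ring
      _ ≤ ε * ‖Y‖ * ((√K * ‖x‖) * (√K * ‖y‖)) := by
          rw [← Finset.mul_sum]
          gcongr
          refine (Real.sum_mul_le_sqrt_mul_sqrt S _ _).trans ?_
          gcongr
          · exact hsum Q Prod.snd x (fun p hp => (hmem p hp).2) hK₂ (hQ x)
          · exact hsum P Prod.fst y (fun p hp => (hmem p hp).1) hK₁ (hP y)
      _ = (√K * √K) * ε * ‖Y‖ * ‖x‖ * ‖y‖ := by ring
      _ = _ := by rw [Real.mul_self_sqrt (Nat.cast_nonneg K)]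
  refine ContinuousLinearMap.opNorm_le_bound _ (by positivity) fun x => ?_
  rcases (norm_nonneg (T x)).eq_or_lt with h0 | h0
  · rw [← h0]
    positivity
  · have := key x (T x)
    rw [inner_self_eq_norm_sq_to_K] at this
    rw [norm_pow, RCLike.norm_ofReal, abs_of_pos h0, sq] at this
    exact le_of_mul_le_mul_right this h0

lemma sum_norm_bumpOp_sq_le {s : ℝ} (hs : 0 < s) {n : ℤ} (N : H →L[ℂ] H) [IsStarNormal N]
    (hN : ‖N‖ ≤ s * n) (x : H) : ∑ i ∈ latticeBox n, ‖bumpOp s N i x‖ ^ 2 ≤ ‖x‖ ^ 2 := by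
  set T := ∑ i ∈ latticeBox n, bumpOp s N i * bumpOp s N i with hT
  have hT1 : ‖T‖ ≤ 1 := by
    have e : T = cfc (∑ i ∈ latticeBox n,
        fun z => (latticeBump s i z : ℂ) * latticeBump s i z) N := by
      rw [cfc_sum _ N]
      exact Finset.sum_congr rfl fun i _ => (cfc_mul _ _ N).symm
    rw [e]
    refine norm_cfc_le zero_le_one fun z hz => ?_
    have h1 := sum_latticeBump hs ((norm_le_of_mem_spectrum hz).trans hN)
    rw [← h1, Finset.sum_apply]
    refine norm_sum_le_of_le _ fun i hi => ?_
    rw [norm_mul, Complex.norm_real, Real.norm_of_nonneg (latticeBump_nonneg s i z)]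
    refine mul_le_of_le_one_left (latticeBump_nonneg s i z) ?_
    rw [← h1]
    exact Finset.single_le_sum (f := fun i => latticeBump s i z)
      (fun j _ => latticeBump_nonneg s j z) hi
  have e : ((∑ i ∈ latticeBox n, ‖bumpOp s N i x‖ ^ 2 : ℝ) : ℂ) = inner ℂ x (T x) := by
    rw [hT, sum_apply, inner_sum]
    rw [Complex.ofReal_sum]
    refine Finset.sum_congr rfl fun i _ => ?_
    rw [mul_apply_eq_comp, Complex.ofReal_pow]
    rw [← ContinuousLinearMap.adjoint_inner_left, ← ContinuousLinearMap.star_eq_adjoint,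
      star_bumpOp, inner_self_eq_norm_sq_to_K]
    rfl
  have h0 : 0 ≤ ∑ i ∈ latticeBox n, ‖bumpOp s N i x‖ ^ 2 := Finset.sum_nonneg fun i _ => sq_nonneg _
  rw [← Real.norm_of_nonneg h0, ← Complex.norm_real, e, sq]
  refine (norm_inner_le_norm _ _).trans ?_
  gcongr
  exact (T.le_of_opNorm_le hT1 x).trans_eq (one_mul _)

lemma norm_cfc_mul_sub_mul_cfc_le {N₁ N₂ Y : H →L[ℂ] H} [IsStarNormal N₁] [IsStarNormal N₂]
    {s : ℝ} (hs : 0 < s) (hY : IsBanded N₁ N₂ Y s) {f : ℂ → ℂ} (hf : Continuous f) {ε : ℝ}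
    (hε : 0 ≤ ε) (h : ∀ z w, ‖z - w‖ < 5 * s → ‖f z - f w‖ ≤ ε) :
    ‖cfc f N₁ * Y - Y * cfc f N₂‖ ≤ 83 * ε * ‖Y‖ := by
  obtain ⟨n, hn⟩ := exists_nat_ge ((‖N₁‖ + ‖N₂‖) / s)
  rw [div_le_iff₀' hs] at hn
  have hn1 : ‖N₁‖ ≤ s * (n : ℤ) := by
    push_cast
    linarith [norm_nonneg N₂]
  have hn2 : ‖N₂‖ ≤ s * (n : ℤ) := by
    push_cast
    linarith [norm_nonneg N₁]
  set J := latticeBox n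
  have hone : ∀ N : H →L[ℂ] H, IsStarNormal N → ‖N‖ ≤ s * (n : ℤ) →
      ∑ i ∈ J, bumpOp s N i = 1 := by
    intro N _ hN
    have := norm_cfc_sub_sum_le hs N hN (g := fun _ => 1) continuous_const le_rfl (by simp)
    rw [cfc_const_one ℂ N] at this
    simp only [one_smul, norm_le_zero_iff] at this
    exact (sub_eq_zero.1 this).symm
  have happ : ∀ N : H →L[ℂ] H, IsStarNormal N → ‖N‖ ≤ s * (n : ℤ) →
      ‖cfc f N - ∑ i ∈ J, f (latticePoint s i) • bumpOp s N i‖ ≤ ε :=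
    fun N _ hN => norm_cfc_sub_sum_le hs N hN hf hε fun z w hzw => h z w (by linarith)
  classical
  set S := (J ×ˢ J).filter fun p => bumpOp s N₁ p.1 * Y * bumpOp s N₂ p.2 ≠ 0
  have hclose : ∀ p ∈ S, ‖latticePoint s p.1 - latticePoint s p.2‖ < 5 * s := by
    intro p hp
    by_contra! hfar
    refine (Finset.mem_filter.1 hp).2 (hY _ _ (by fun_prop) (by fun_prop) ?_)
    intro z w hz hw
    have h1 := dist_latticePoint_lt hs (by exact_mod_cast hz)
    have h2 := dist_latticePoint_lt hs (by exact_mod_cast hw)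
    have h3 := norm_add_le ((z - w) - (z - latticePoint s p.1)) (w - latticePoint s p.2)
    have h4 := norm_sub_le (z - w) (z - latticePoint s p.1)
    have e : (z - w) - (z - latticePoint s p.1) + (w - latticePoint s p.2) =
      latticePoint s p.1 - latticePoint s p.2 := by ring
    rw [e] at h3
    linarith
  have hcard : ∀ i : ℤ × ℤ,
      (Finset.Icc (i.1 - 4) (i.1 + 4) ×ˢ Finset.Icc (i.2 - 4) (i.2 + 4)).card = 81 := by
    intro i
    rw [Finset.card_product, Int.card_Icc, Int.card_Icc]
    have e : ∀ k : ℤ, (k + 4 + 1 - (k - 4)).toNat = 9 := by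
      intro k
      omega
    rw [e, e]
  have hK₁ : ∀ i ∈ J, (S.filter (·.1 = i)).card ≤ 81 := by
    intro i _
    rw [← hcard i]
    refine Finset.card_le_card_of_injOn Prod.snd (fun p hp => ?_) (fun p hp q hq hpq => ?_)
    · obtain ⟨hpS, rfl⟩ := Finset.mem_filter.1 hp
      exact abs_sub_le_of_norm_latticePoint_sub_lt hs (k := 4)
        ((hclose p hpS).trans_eq (by norm_num))
    · exact Prod.ext ((Finset.mem_filter.1 hp).2.trans (Finset.mem_filter.1 hq).2.symm) hpq
  have hK₂ : ∀ i ∈ J, (S.filter (·.2 = i)).card ≤ 81 := by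
    intro i _
    rw [← hcard i]
    refine Finset.card_le_card_of_injOn Prod.fst (fun p hp => ?_) (fun p hp q hq hpq => ?_)
    · obtain ⟨hpS, rfl⟩ := Finset.mem_filter.1 hp
      refine abs_sub_le_of_norm_latticePoint_sub_lt hs (k := 4) ?_
      rw [norm_sub_rev]
      exact (hclose p hpS).trans_eq (by norm_num)
    · exact Prod.ext hpq ((Finset.mem_filter.1 hp).2.trans (Finset.mem_filter.1 hq).2.symm)
  have hschur := norm_sum_smul_mul_mul_le J S (Finset.filter_subset _ _) hK₁ hK₂
    (bumpOp s N₁) (bumpOp s N₂) (star_bumpOp s N₁) (sum_norm_bumpOp_sq_le hs N₁ hn1)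
    (sum_norm_bumpOp_sq_le hs N₂ hn2) Y
    (fun p => f (latticePoint s p.1) - f (latticePoint s p.2)) hε fun p hp => h _ _ (hclose p hp)
  set F₁ := ∑ i ∈ J, f (latticePoint s i) • bumpOp s N₁ i with hF₁
  set F₂ := ∑ i ∈ J, f (latticePoint s i) • bumpOp s N₂ i with hF₂
  have hcomm : F₁ * Y - Y * F₂ = ∑ p ∈ S, (f (latticePoint s p.1) - f (latticePoint s p.2)) •
      (bumpOp s N₁ p.1 * Y * bumpOp s N₂ p.2) := by
    have e1 : F₁ * Y = F₁ * Y * ∑ j ∈ J, bumpOp s N₂ j := by rw [hone N₂ inferInstance hn2, mul_one]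
    have e2 : Y * F₂ = (∑ i ∈ J, bumpOp s N₁ i) * Y * F₂ := by
      rw [hone N₁ inferInstance hn1, one_mul]
    rw [e1, e2, Finset.sum_filter_of_ne fun p _ hp => right_ne_zero_of_smul hp,
      Finset.sum_product, hF₁, hF₂]
    simp only [Finset.sum_mul, ← Finset.sum_sub_distrib]
    refine Finset.sum_congr rfl fun i _ => ?_
    rw [Finset.mul_sum, Finset.mul_sum, ← Finset.sum_sub_distrib]
    refine Finset.sum_congr rfl fun j _ => ?_
    rw [sub_smul, smul_mul_assoc, smul_mul_assoc, mul_smul_comm]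
  have e : cfc f N₁ * Y - Y * cfc f N₂ =
      (cfc f N₁ - F₁) * Y - Y * (cfc f N₂ - F₂) + (F₁ * Y - Y * F₂) := by noncomm_ring
  rw [e, hcomm]
  calc _ ≤ ε * ‖Y‖ + ‖Y‖ * ε + (81 : ℕ) * ε * ‖Y‖ := by
        refine (norm_add_le _ _).trans (add_le_add ((norm_sub_le _ _).trans
          (add_le_add ?_ ?_)) hschur)
        · refine (norm_mul_le _ _).trans ?_
          gcongr
          exact happ N₁ inferInstance hn1
        · refine (norm_mul_le _ _).trans ?_
          gcongr
          exact happ N₂ inferInstance hn2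
    _ = _ := by
        push_cast
        ring

end Schur

lemma IsModulusOfContinuity.map_two_mul_le {ω : ℝ → ℝ} (hω : IsModulusOfContinuity ω) {x : ℝ}
    (hx : 0 ≤ x) : ω (2 * x) ≤ 2 * ω x := by
  rw [two_mul, two_mul]
  exact hω.subadditive x x hx hx

lemma sum_div_two_pow_le {ω : ℝ → ℝ} (hω : IsModulusOfContinuity ω)
    (hint : ∀ x : ℝ, 0 < x → IntegrableOn (fun t => ω t / t ^ 2) (Set.Ioi x)) (n : ℕ) :
    ∀ x : ℝ, 0 < x → ∑ k ∈ Finset.range n, ω (2 ^ k * x) / 2 ^ k ≤ 4 * omegaStar ω x := by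
  have hnn : ∀ t : ℝ, 0 < t → 0 ≤ ω t / t ^ 2 :=
    fun t ht => div_nonneg (hω.pos t ht).le (sq_nonneg t)
  induction n with
  | zero =>
    intro x hx
    have : 0 ≤ ∫ t in Set.Ioi x, ω t / t ^ 2 :=
      setIntegral_nonneg measurableSet_Ioi fun t ht => hnn t (hx.trans ht)
    rw [Finset.sum_range_zero, omegaStar]
    positivity
  | succ n ih =>
    intro x hx
    have h1 := ih (2 * x) (by positivity)
    have h2 : ∫ t in Set.Ioi x, ω t / t ^ 2 =
        (∫ t in Set.Ioc x (2 * x), ω t / t ^ 2) + ∫ t in Set.Ioi (2 * x), ω t / t ^ 2 := by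
      rw [← setIntegral_union (Set.Ioc_disjoint_Ioi le_rfl) measurableSet_Ioi
        ((hint x hx).mono_set Set.Ioc_subset_Ioi_self) (hint _ (by positivity)),
        Set.Ioc_union_Ioi_eq_Ioi (by linarith)]
    have h3 : ω x / (2 * x) ^ 2 * volume.real (Set.Ioc x (2 * x)) ≤
        ∫ t in Set.Ioc x (2 * x), ω t / t ^ 2 := by
      refine setIntegral_ge_of_const_le_real measurableSet_Ioc (by simp) (fun t ht => ?_)
        ((hint x hx).mono_set Set.Ioc_subset_Ioi_self)
      have ht0 := hx.trans ht.1
      have h4 := hω.pos t ht0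
      have h5 := hω.monotoneOn (Set.mem_Ici.2 hx.le) (Set.mem_Ici.2 ht0.le) ht.1.le
      have h6 := ht.2
      gcongr
    have hvol : volume.real (Set.Ioc x (2 * x)) = x := by
      rw [Real.volume_real_Ioc_of_le (by linarith)]
      ring
    rw [hvol] at h3
    have h4 : ω x ≤ 4 * x * ∫ t in Set.Ioc x (2 * x), ω t / t ^ 2 := by
      calc ω x = 4 * x * (ω x / (2 * x) ^ 2 * x) := by
            field_simp
            norm_num
        _ ≤ _ := by gcongr
    have h5 : ∑ k ∈ Finset.range n, ω (2 ^ (k + 1) * x) / 2 ^ (k + 1) =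
        (∑ k ∈ Finset.range n, ω (2 ^ k * (2 * x)) / 2 ^ k) / 2 := by
      rw [Finset.sum_div]
      refine Finset.sum_congr rfl fun k _ => ?_
      rw [pow_succ, ← mul_assoc, div_div]
    rw [Finset.sum_range_succ', h5]
    unfold omegaStar at h1 ⊢
    rw [h2]
    simp only [pow_zero, one_mul, div_one]
    linarith

/-- There is an absolute constant `c > 0` such that: if `ω` is a modulus of continuity
and `C₀ > 0` satisfies `ω*(x) ≤ C₀ ω(x)` for all `x > 0` (with `ω*(x)` finite, i.e.
`t ↦ ω(t)/t²` integrable on `(x,∞)`), then for every `f ∈ Λ_ω(ℝ²)` with `‖f‖_{Λ_ω} ≤ M`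
and all bounded normal operators `N₁ ≠ N₂`,
`‖f(N₁) - f(N₂)‖ ≤ c C₀ M ω(‖N₁ - N₂‖)`. -/
theorem modulus_of_continuity_operator_bound_self_majorized :
    ∃ c : ℝ, 0 < c ∧
      ∀ (ω : ℝ → ℝ), IsModulusOfContinuity ω →
      ∀ (C₀ : ℝ), 0 < C₀ →
      (∀ x : ℝ, 0 < x →
        IntegrableOn (fun t => ω t / t ^ 2) (Set.Ioi x) ∧ omegaStar ω x ≤ C₀ * ω x) →
      ∀ (f : ℂ → ℂ) (M : ℝ), 0 ≤ M →
      (∀ z₁ z₂ : ℂ, ‖f z₁ - f z₂‖ ≤ M * ω ‖z₁ - z₂‖) →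
      ∀ (H : Type*) [NormedAddCommGroup H] [InnerProductSpace ℂ H] [CompleteSpace H]
        (N₁ N₂ : H →L[ℂ] H), IsStarNormal N₁ → IsStarNormal N₂ → N₁ ≠ N₂ →
        ‖cfc f N₁ - cfc f N₂‖ ≤ c * C₀ * M * ω ‖N₁ - N₂‖ := by
  obtain ⟨m, hc, hm, hm', hm1, hm0⟩ := exists_bandlimited_kernel
  obtain ⟨C, hC⟩ : ∃ C : ℝ, C = 2 * Real.pi * ∫ ξ, ‖ξ‖ * ‖m ξ‖ := ⟨_, rfl⟩
  have hC0 : 0 ≤ C :=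
    hC ▸ mul_nonneg (by positivity) (integral_nonneg fun ξ => by positivity)
  obtain ⟨L, hL⟩ : ∃ L : ℝ, L = 83 * 8 * (1 + 4 * C) := ⟨_, rfl⟩
  have hL0 : 0 < L := by rw [hL]; positivity
  refine ⟨8 * L, by positivity, ?_⟩
  intro ω hω C₀ hC₀ hstar f M hM hf H _ _ _ N₁ N₂ hN₁ hN₂ hne
  set δ := ‖N₁ - N₂‖ with hδ
  have hδ0 : 0 < δ := norm_pos_iff.2 (sub_ne_zero.2 hne)
  have hfc : Continuous f := by
    refine continuous_iff_continuousAt.2 fun z => ?_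
    rw [ContinuousAt, tendsto_iff_norm_sub_tendsto_zero]
    have h : Continuous fun w : ℂ => M * ω ‖w - z‖ :=
      continuous_const.mul (hω.continuousOn.comp_continuous (by fun_prop) fun w => norm_nonneg _)
    have h0 := h.tendsto z
    rw [sub_self, norm_zero, hω.map_zero, mul_zero] at h0
    exact squeeze_zero (fun _ => norm_nonneg _) (fun w => hf w z) h0
  let D : (H →L[ℂ] H) → (H →L[ℂ] H) := fun Y => cfc f N₁ * Y - Y * cfc f N₂
  have hω0 : ∀ t, 0 ≤ t → 0 ≤ ω t := fun t ht =>
    hω.map_zero.ge.trans (hω.monotoneOn Set.self_mem_Ici ht ht)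
  have hD : ∀ (s : ℝ) (Y : H →L[ℂ] H), 0 < s → IsBanded N₁ N₂ Y s →
      ‖D Y‖ ≤ 83 * (M * (8 * ω s)) * ‖Y‖ := by
    intro s Y hs hY
    have h8 : ω (2 * (2 * (2 * s))) ≤ 8 * ω s := by
      have h1 := hω.map_two_mul_le hs.le
      have h2 := hω.map_two_mul_le (x := 2 * s) (by positivity)
      have h3 := hω.map_two_mul_le (x := 2 * (2 * s)) (by positivity)
      linarith
    refine norm_cfc_mul_sub_mul_cfc_le hs hY hfc
      (mul_nonneg hM (mul_nonneg (by norm_num) (hω0 s hs.le))) fun z w hzw => ?_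
    refine (hf z w).trans (mul_le_mul_of_nonneg_left (le_trans ?_ h8) hM)
    exact hω.monotoneOn (norm_nonneg _) (Set.mem_Ici.2 (by positivity)) (by linarith)
  let E : ℕ → H →L[ℂ] H := fun n => smear m N₁ N₂ (2 ^ n * δ)
  have hEband : ∀ n, IsBanded N₁ N₂ (E n) (2 ^ n * δ) := fun n =>
    isBanded_smear N₁ N₂ hc hm hm' hm0 (by positivity)
  have hE : ∀ n, ‖1 - E n‖ ≤ C / 2 ^ n := by
    intro n
    refine (norm_one_sub_smear_le N₁ N₂ hc hm hm' hm1 (by positivity)).trans (le_of_eq ?_)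
    rw [← hδ, ← hC]
    field_simp
  have hDE : ∀ n, ‖D (E n)‖ ≤
      L * M * (ω δ + ∑ k ∈ Finset.range n, ω (2 ^ k * δ) / 2 ^ k) := by
    intro n
    induction n with
    | zero =>
      have h1 := hD _ _ (by positivity) (hEband 0)
      have h2 : ‖E 0‖ ≤ 1 + 4 * C := by
        have e : E 0 = 1 - (1 - E 0) := by abel
        rw [e]
        refine (norm_sub_le _ _).trans (add_le_add norm_one_le_one ((hE 0).trans ?_))
        rw [pow_zero, div_one]
        linarith
      rw [pow_zero, one_mul] at h1
      rw [Finset.sum_range_zero, add_zero]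
      have h3 := hω0 δ hδ0.le
      calc _ ≤ 83 * (M * (8 * ω δ)) * (1 + 4 * C) := h1.trans (by gcongr)
        _ = _ := by rw [hL]; ring
    | succ n ih =>
      have hb : IsBanded N₁ N₂ (E (n + 1) - E n) (2 ^ (n + 1) * δ) := by
        refine (hEband (n + 1)).sub ((hEband n).mono ?_)
        gcongr
        · norm_num
        · omega
      have h1 := hD _ _ (by positivity) hb
      have h2 : ‖E (n + 1) - E n‖ ≤ 2 * C / 2 ^ n := by
        have e : E (n + 1) - E n = (1 - E n) - (1 - E (n + 1)) := by abel
        rw [e]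
        refine (norm_sub_le _ _).trans ((add_le_add (hE n) (hE (n + 1))).trans ?_)
        rw [pow_succ]
        have : 0 ≤ C / 2 ^ n := by positivity
        have e2 : C / (2 ^ n * 2) = C / 2 ^ n / 2 := by rw [div_div]
        rw [e2, mul_div_assoc 2 C]
        linarith
      have h3 : ω (2 ^ (n + 1) * δ) ≤ 2 * ω (2 ^ n * δ) := by
        rw [pow_succ', mul_assoc]
        exact hω.map_two_mul_le (by positivity)
      have h4 := hω0 (2 ^ n * δ) (by positivity)
      have e : D (E (n + 1)) = D (E n) + D (E (n + 1) - E n) := by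
        simp only [D]
        noncomm_ring
      rw [e, Finset.sum_range_succ, ← add_assoc, mul_add]
      refine (norm_add_le _ _).trans (add_le_add ih ?_)
      calc _ ≤ 83 * (M * (8 * (2 * ω (2 ^ n * δ)))) * (2 * C / 2 ^ n) := h1.trans (by gcongr)
        _ = (83 * 8 * (4 * C)) * (M * (ω (2 ^ n * δ) / 2 ^ n)) := by ring
        _ ≤ L * (M * (ω (2 ^ n * δ) / 2 ^ n)) := by
            gcongr
            rw [hL]
            linarith
        _ = _ := by ring
  have hsum : ∀ n, ‖D (E n)‖ ≤ L * M * (8 * C₀ * ω δ) := by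
    intro n
    refine (hDE n).trans ?_
    have h1 : ∀ k, ∑ k ∈ Finset.range k, ω (2 ^ k * δ) / 2 ^ k ≤ 4 * (C₀ * ω δ) := fun k =>
      (sum_div_two_pow_le hω (fun x hx => (hstar x hx).1) k δ hδ0).trans
        (by linarith [(hstar δ hδ0).2])
    have h2 := h1 1
    rw [Finset.sum_range_one, pow_zero, one_mul, div_one] at h2
    have h3 := h1 n
    exact mul_le_mul_of_nonneg_left (by linarith) (by positivity)
  have hlim : Filter.Tendsto E Filter.atTop (nhds 1) := by
    rw [tendsto_iff_norm_sub_tendsto_zero]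
    refine squeeze_zero (g := fun n => C / 2 ^ n) (fun _ => norm_nonneg _)
      (fun n => (norm_sub_rev _ _).trans_le (hE n)) ?_
    have := (tendsto_pow_atTop_nhds_zero_of_lt_one (r := (1 / 2 : ℝ)) (by norm_num)
      (by norm_num)).const_mul C
    simpa [div_eq_mul_inv] using this
  have hDc : Continuous D := by
    simp only [D]
    fun_prop
  have hfin := le_of_tendsto ((hDc.tendsto 1).comp hlim).norm
    (Filter.Eventually.of_forall fun n => hsum n)
  simp only [D, mul_one, one_mul] at hfin
  refine hfin.trans (le_of_eq ?_)
  ring
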